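/- arXiv:1603.07181 — 3 statements merged into one kernel-verified Lean document; each statement's English description precedes it below -/
import Mathlib

section
/- Let X, Y be nonempty finite sets, L a linear subspace of real-valued functions on X × Y, p a strictly positive probability distribution on X, k ∈ K(X;Y) a channel, and k₀ ∈ K(X;Y) a strictly positive channel. Let E be the closure of the exponential family E(k₀,L) and M = M_p(k,L) the mixture family. Then for a channel k' ∈ K(X;Y): k' ∈ M ∩ E if and only if k' ∈ M and D_p(k'||k₀) = inf_{m ∈ M} D_p(m||k₀). -/
open scoped ENNReal BigOperators

/-- `k : X × Y → ℝ` is a channel (Markov kernel) from `X` to `Y`: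
nonnegative entries, rows summing to one. -/
def IsChannel {X Y : Type} [Fintype Y] (k : X × Y → ℝ) : Prop :=
  (∀ z, 0 ≤ k z) ∧ ∀ x : X, ∑ y : Y, k (x, y) = 1

/-- Channel divergence `D_p(k‖m)`, valued in `[0,∞]`, with the conventions
`0·log(0/t) = 0` and `t·log(t/0) = ∞` for `t > 0`. -/
noncomputable def chanDiv {X Y : Type} [Fintype X] [Fintype Y]
    (p : X → ℝ) (k m : X × Y → ℝ) : ℝ≥0∞ :=
  if ∀ z : X × Y, p z.1 * k z ≠ 0 → m z ≠ 0 then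
    ENNReal.ofReal (∑ z : X × Y, p z.1 * k z * Real.log (k z / m z))
  else ⊤

/-- The mixture family `M_p(k, L)` generated by the channel `k` and the linear
subspace `L` of functions on `X × Y`, with respect to the input distribution `p`. -/
def mixFam {X Y : Type} [Fintype X] [Fintype Y] (p : X → ℝ) (k : X × Y → ℝ)
    (L : Submodule ℝ (X × Y → ℝ)) : Set (X × Y → ℝ) :=
  {m | IsChannel m ∧
    ∀ l ∈ L, ∑ z : X × Y, p z.1 * m z * l z = ∑ z : X × Y, p z.1 * k z * l z}

/-- The exponential family `E(k₀, L)` generated by the reference channel `k₀` and the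
linear subspace `L` of functions on `X × Y`. -/
noncomputable def expFam {X Y : Type} [Fintype Y] (k₀ : X × Y → ℝ)
    (L : Submodule ℝ (X × Y → ℝ)) : Set (X × Y → ℝ) :=
  {m | ∃ l ∈ L, m = fun z : X × Y =>
    Real.exp (l z) * k₀ z / ∑ y : Y, Real.exp (l (z.1, y)) * k₀ (z.1, y)}

/-- The row normalizer of the exponential tilt of `k₀` by `l`. -/
noncomputable def tiltNorm {X Y : Type} [Fintype Y] (k₀ l : X × Y → ℝ) (x : X) : ℝ :=
  ∑ y : Y, Real.exp (l (x, y)) * k₀ (x, y)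

/-- The exponential tilt of `k₀` by `l`, normalized to a channel. -/
noncomputable def tilt {X Y : Type} [Fintype Y] (k₀ l : X × Y → ℝ) : X × Y → ℝ :=
  fun z => Real.exp (l z) * k₀ z / tiltNorm k₀ l z.1

/-- The real-valued expression of the divergence `D_p(m‖e)`. -/
noncomputable def realDiv {X Y : Type} [Fintype X] [Fintype Y]
    (p : X → ℝ) (m e : X × Y → ℝ) : ℝ :=
  ∑ z : X × Y, p z.1 * m z * Real.log (m z / e z)

/-- The squared Hellinger distance of two channels, weighted by `p`. -/
noncomputable def hellSq {X Y : Type} [Fintype X] [Fintype Y]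
    (p : X → ℝ) (m e : X × Y → ℝ) : ℝ :=
  ∑ z : X × Y, p z.1 * (√(m z) - √(e z)) ^ 2

/-- The negative of the dual objective: `E_{p,k}[l] - E_p[log Z_l]`. -/
noncomputable def dualVal {X Y : Type} [Fintype X] [Fintype Y]
    (p : X → ℝ) (k k₀ l : X × Y → ℝ) : ℝ :=
  ∑ z : X × Y, p z.1 * k z * l z - ∑ x, p x * Real.log (tiltNorm k₀ l x)

section
variable {X Y : Type} [Fintype Y]

theorem tiltNorm_pos [Nonempty Y] {k₀ : X × Y → ℝ} (hk₀ : ∀ z, 0 < k₀ z) (l : X × Y → ℝ) (x : X) :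
    0 < tiltNorm k₀ l x :=
  Finset.sum_pos (fun _ _ => mul_pos (Real.exp_pos _) (hk₀ _)) Finset.univ_nonempty

theorem tilt_pos [Nonempty Y] {k₀ : X × Y → ℝ} (hk₀ : ∀ z, 0 < k₀ z) (l : X × Y → ℝ) (z : X × Y) :
    0 < tilt k₀ l z :=
  div_pos (mul_pos (Real.exp_pos _) (hk₀ _)) (tiltNorm_pos hk₀ l _)

theorem isChannel_tilt [Nonempty Y] {k₀ : X × Y → ℝ} (hk₀ : ∀ z, 0 < k₀ z) (l : X × Y → ℝ) :
    IsChannel (tilt k₀ l) := by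
  refine ⟨fun z => (tilt_pos hk₀ l z).le, fun x => ?_⟩
  simp only [tilt]
  rw [← Finset.sum_div]
  exact div_self (tiltNorm_pos hk₀ l x).ne'

theorem isCompact_setOf_isChannel [Fintype X] : IsCompact {m : X × Y → ℝ | IsChannel m} := by
  refine (isCompact_Icc (a := (0 : X × Y → ℝ)) (b := 1)).of_isClosed_subset ?_ ?_
  · simp only [IsChannel, Set.ofPred_and, Set.ofPred_forall]
    refine (isClosed_iInter fun z => isClosed_le continuous_const (continuous_apply z)).inter
      (isClosed_iInter fun x => isClosed_eq ?_ continuous_const)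
    fun_prop
  · rintro m ⟨h0, h1⟩
    refine ⟨h0, fun z => ?_⟩
    have := Finset.single_le_sum (f := fun y => m (z.1, y)) (fun y _ => h0 _) (Finset.mem_univ z.2)
    simpa [h1 z.1] using this

variable [Fintype X]

theorem IsChannel.sum_mul_fst {m : X × Y → ℝ} (hm : IsChannel m) (f : X → ℝ) :
    ∑ z : X × Y, f z.1 * m z = ∑ x, f x := by
  rw [Fintype.sum_prod_type]
  refine Finset.sum_congr rfl fun x _ => ?_
  simp only [← Finset.mul_sum, hm.2 x, mul_one]

theorem sq_sqrt_sub_sqrt_add_sub_le {a b : ℝ} (ha : 0 ≤ a) (hb : 0 < b) :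
    (√a - √b) ^ 2 + (a - b) ≤ a * Real.log (a / b) := by
  rcases ha.eq_or_lt with rfl | ha
  · simp [Real.sq_sqrt hb.le]
  have hsa := Real.sqrt_pos.2 ha
  have hsb := Real.sqrt_pos.2 hb
  have h := Real.one_sub_inv_le_log_of_pos (div_pos hsa hsb)
  rw [← Real.sqrt_div ha.le, Real.log_sqrt (div_pos ha hb).le, Real.sqrt_div ha.le, inv_div] at h
  have h2 : a * (2 * (1 - √b / √a)) ≤ a * Real.log (a / b) :=
    mul_le_mul_of_nonneg_left (by linarith) ha.le
  have h3 : a * (√b / √a) = √a * √b := by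
    field_simp
    rw [Real.sq_sqrt ha.le]
  nlinarith [Real.sq_sqrt ha.le, Real.sq_sqrt hb.le]

theorem hellSq_le_realDiv {p : X → ℝ} (hp : ∀ x, 0 < p x) {m e : X × Y → ℝ}
    (hm : IsChannel m) (he : IsChannel e) (he0 : ∀ z, 0 < e z) :
    hellSq p m e ≤ realDiv p m e := by
  have h : ∑ z : X × Y, p z.1 * ((√(m z) - √(e z)) ^ 2 + (m z - e z)) ≤ realDiv p m e := by
    refine Finset.sum_le_sum fun z _ => ?_
    rw [mul_assoc]
    exact mul_le_mul_of_nonneg_left (sq_sqrt_sub_sqrt_add_sub_le (hm.1 z) (he0 z)) (hp _).le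
  simp only [mul_add, mul_sub, Finset.sum_add_distrib, Finset.sum_sub_distrib,
    hm.sum_mul_fst, he.sum_mul_fst, sub_self, add_zero] at h
  simpa only [hellSq, mul_sub] using h

theorem hellSq_nonneg {p : X → ℝ} (hp : ∀ x, 0 < p x) (m e : X × Y → ℝ) : 0 ≤ hellSq p m e :=
  Finset.sum_nonneg fun _ _ => mul_nonneg (hp _).le (sq_nonneg _)

theorem eq_of_hellSq_le_zero {p : X → ℝ} (hp : ∀ x, 0 < p x) {m e : X × Y → ℝ}
    (hm : IsChannel m) (he : IsChannel e) (h : hellSq p m e ≤ 0) : m = e := by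
  have h0 := le_antisymm h (hellSq_nonneg hp m e)
  rw [hellSq, Finset.sum_eq_zero_iff_of_nonneg
    fun z _ => mul_nonneg (hp _).le (sq_nonneg _)] at h0
  funext z
  have hz := h0 z (Finset.mem_univ z)
  rw [mul_eq_zero, or_iff_right (hp _).ne', sq_eq_zero_iff, sub_eq_zero] at hz
  exact (Real.sqrt_inj (hm.1 z) (he.1 z)).1 hz

theorem continuous_hellSq (p : X → ℝ) (m : X × Y → ℝ) : Continuous (hellSq p m) := by
  unfold hellSq
  fun_prop

theorem continuousAt_realDiv_self (p : X → ℝ) (m : X × Y → ℝ) :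
    ContinuousAt (realDiv p m) m := by
  unfold realDiv
  refine tendsto_finsetSum _ fun z _ => ?_
  by_cases hz : m z = 0
  · simp [hz]
  · exact ((continuousAt_const.div (continuous_apply z).continuousAt hz).log
      (by simp [hz])).const_mul _

theorem realDiv_self (p : X → ℝ) (m : X × Y → ℝ) : realDiv p m m = 0 := by
  refine Finset.sum_eq_zero fun z _ => ?_
  by_cases hz : m z = 0 <;> simp [hz]

theorem dualVal_zero (p : X → ℝ) (k : X × Y → ℝ) {k₀ : X × Y → ℝ} (hk₀ : IsChannel k₀) :
    dualVal p k k₀ 0 = 0 := by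
  simp [dualVal, tiltNorm, hk₀.2]

theorem norm_sq_le_sum_sq {ι : Type*} [Fintype ι] (l : ι → ℝ) : ‖l‖ ^ 2 ≤ ∑ i, l i ^ 2 := by
  rw [← Real.le_sqrt (norm_nonneg _) (Finset.sum_nonneg fun i _ => sq_nonneg _)]
  refine (pi_norm_le_iff_of_nonneg (Real.sqrt_nonneg _)).2 fun i => ?_
  refine Real.le_sqrt_of_sq_le ?_
  rw [Real.norm_eq_abs, sq_abs]
  exact Finset.single_le_sum (f := fun i => l i ^ 2) (fun i _ => sq_nonneg _) (Finset.mem_univ i)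

theorem chanDiv_eq_ofReal_realDiv (p : X → ℝ) (m : X × Y → ℝ) {k₀ : X × Y → ℝ}
    (hk₀ : ∀ z, 0 < k₀ z) : chanDiv p m k₀ = ENNReal.ofReal (realDiv p m k₀) :=
  if_pos fun z _ => (hk₀ z).ne'

variable [Nonempty Y]

theorem realDiv_sub_realDiv_tilt {p : X → ℝ} {m k₀ : X × Y → ℝ}
    (hm : IsChannel m) (hk₀ : ∀ z, 0 < k₀ z) (l : X × Y → ℝ) :
    realDiv p m k₀ - realDiv p m (tilt k₀ l) = dualVal p m k₀ l := by
  rw [dualVal, ← hm.sum_mul_fst (fun x => p x * Real.log (tiltNorm k₀ l x)), realDiv, realDiv,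
    ← Finset.sum_sub_distrib, ← Finset.sum_sub_distrib]
  refine Finset.sum_congr rfl fun z _ => ?_
  rcases (hm.1 z).eq_or_lt with hz | hz
  · simp [← hz]
  have hZ := tiltNorm_pos hk₀ l z.1
  rw [Real.log_div hz.ne' (hk₀ z).ne', Real.log_div hz.ne' (tilt_pos hk₀ l z).ne', tilt,
    Real.log_div (mul_pos (Real.exp_pos _) (hk₀ z)).ne' hZ.ne',
    Real.log_mul (Real.exp_pos _).ne' (hk₀ z).ne', Real.log_exp]
  ring

theorem dualVal_le_realDiv {p : X → ℝ} (hp : ∀ x, 0 < p x) {m k₀ : X × Y → ℝ}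
    (hm : IsChannel m) (hk₀ : ∀ z, 0 < k₀ z) (l : X × Y → ℝ) :
    dualVal p m k₀ l ≤ realDiv p m k₀ := by
  have h1 := hellSq_le_realDiv hp hm (isChannel_tilt hk₀ l) (tilt_pos hk₀ l)
  have h2 := hellSq_nonneg hp m (tilt k₀ l)
  have h3 := realDiv_sub_realDiv_tilt (p := p) hm hk₀ l
  linarith

/-- A Pythagorean inequality for the divergence from `k₀`. -/
theorem realDiv_add_hellSq_le {L : Submodule ℝ (X × Y → ℝ)} {p : X → ℝ} (hp : ∀ x, 0 < p x)
    {k k₀ m m₀ : X × Y → ℝ} (hk₀ : ∀ z, 0 < k₀ z) (hm : m ∈ mixFam p k L)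
    (hm₀ : m₀ ∈ mixFam p k L) (hcl : m₀ ∈ closure (expFam k₀ L)) :
    realDiv p m₀ k₀ + hellSq p m m₀ ≤ realDiv p m k₀ := by
  have key : ∀ e ∈ expFam k₀ L,
      realDiv p m₀ k₀ + hellSq p m e ≤ realDiv p m k₀ + realDiv p m₀ e := by
    rintro _ ⟨l, hl, rfl⟩
    change realDiv p m₀ k₀ + hellSq p m (tilt k₀ l) ≤
      realDiv p m k₀ + realDiv p m₀ (tilt k₀ l)
    have h1 := hellSq_le_realDiv hp hm.1 (isChannel_tilt hk₀ l) (tilt_pos hk₀ l)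
    have h2 := realDiv_sub_realDiv_tilt (p := p) hm.1 hk₀ l
    have h3 := realDiv_sub_realDiv_tilt (p := p) hm₀.1 hk₀ l
    have h4 : dualVal p m k₀ l = dualVal p m₀ k₀ l := by
      rw [dualVal, dualVal, hm.2 l hl, hm₀.2 l hl]
    linarith
  have := mem_closure_iff_nhdsWithin_neBot.1 hcl
  have hlim := le_of_tendsto_of_tendsto (b := nhdsWithin m₀ (expFam k₀ L))
    (((continuous_hellSq p m).tendsto m₀).const_add (realDiv p m₀ k₀) |>.mono_left
      nhdsWithin_le_nhds)
    ((ContinuousAt.tendsto (continuousAt_realDiv_self p m₀)).const_add (realDiv p m k₀) |>.mono_left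
      nhdsWithin_le_nhds)
    (eventually_nhdsWithin_of_forall key)
  simpa [realDiv_self] using hlim

theorem continuous_dualVal (p : X → ℝ) (k : X × Y → ℝ) {k₀ : X × Y → ℝ} (hk₀ : ∀ z, 0 < k₀ z) :
    Continuous (dualVal p k k₀) := by
  unfold dualVal
  refine Continuous.sub (by fun_prop) (continuous_finsetSum _ fun x _ => ?_)
  refine continuous_const.mul (Continuous.log ?_ fun l => (tiltNorm_pos hk₀ l x).ne')
  unfold tiltNorm
  fun_prop

theorem hasDerivAt_dualVal (p : X → ℝ) (k : X × Y → ℝ) {k₀ : X × Y → ℝ} (hk₀ : ∀ z, 0 < k₀ z)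
    (l h : X × Y → ℝ) :
    HasDerivAt (fun t : ℝ => dualVal p k k₀ (l + t • h))
      (∑ z, p z.1 * k z * h z - ∑ z, p z.1 * tilt k₀ l z * h z) 0 := by
  have hline : ∀ z, HasDerivAt (fun t : ℝ => (l + t • h) z) (h z) 0 := fun z => by
    simpa using ((hasDerivAt_id (0 : ℝ)).mul_const (h z)).const_add (l z)
  have hZ : ∀ x, HasDerivAt (fun t : ℝ => tiltNorm k₀ (l + t • h) x)
      (∑ y, Real.exp (l (x, y)) * h (x, y) * k₀ (x, y)) 0 := fun x => by
    unfold tiltNorm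
    refine HasDerivAt.fun_sum fun y _ => ?_
    simpa using (hline (x, y)).exp.mul_const (k₀ (x, y))
  have hlog : ∀ x, HasDerivAt (fun t : ℝ => p x * Real.log (tiltNorm k₀ (l + t • h) x))
      (∑ y, p x * tilt k₀ l (x, y) * h (x, y)) 0 := fun x => by
    refine (((hZ x).log (tiltNorm_pos hk₀ _ x).ne').const_mul (p x)).congr_deriv ?_
    simp only [zero_smul, add_zero, tilt]
    rw [Finset.sum_div, Finset.mul_sum]
    refine Finset.sum_congr rfl fun y _ => ?_
    ring
  rw [Fintype.sum_prod_type (fun z => p z.1 * tilt k₀ l z * h z)]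
  exact (HasDerivAt.fun_sum fun z _ => (hline z).const_mul (p z.1 * k z)).sub
    (HasDerivAt.fun_sum fun x _ => hlog x)

/-- Maximizing the dual objective with a quadratic penalty `ε` gives a member of the exponential
family that satisfies the constraints of the mixture family up to `O(√ε)`. -/
theorem exists_tilt_moment_le {L : Submodule ℝ (X × Y → ℝ)} {p : X → ℝ} (hp : ∀ x, 0 < p x)
    {k k₀ : X × Y → ℝ} (hk : IsChannel k) (hk₀ : IsChannel k₀) (hk₀_pos : ∀ z, 0 < k₀ z)
    {ε : ℝ} (hε : 0 < ε) :
    ∃ l ∈ L, ∀ h ∈ L,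
      |∑ z, p z.1 * k z * h z - ∑ z, p z.1 * tilt k₀ l z * h z| ≤
        2 * √(ε * realDiv p k k₀) * ∑ z, |h z| := by
  let G : L → ℝ := fun l => ε * ∑ z, (l : X × Y → ℝ) z ^ 2 - dualVal p k k₀ l
  have hG : Continuous G := by
    refine Continuous.sub (continuous_const.mul (continuous_finsetSum _ fun z _ =>
      ((continuous_apply z).comp continuous_subtype_val).pow 2))
      ((continuous_dualVal p k hk₀_pos).comp continuous_subtype_val)
  have hlow : ∀ l : L, ε * ‖l‖ ^ 2 - realDiv p k k₀ ≤ G l := fun l => by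
    have h1 := dualVal_le_realDiv hp hk hk₀_pos (l : X × Y → ℝ)
    have h2 := mul_le_mul_of_nonneg_left (norm_sq_le_sum_sq (l : X × Y → ℝ)) hε.le
    simp only [G, Submodule.coe_norm] at *
    linarith
  have hcoer : Filter.Tendsto G (Filter.cocompact L) Filter.atTop := by
    refine Filter.tendsto_atTop_mono hlow (Filter.tendsto_atTop_add_const_right _ _ ?_)
    exact ((Filter.tendsto_pow_atTop two_ne_zero).comp
      (tendsto_norm_cocompact_atTop (E := L))).const_mul_atTop hε
  obtain ⟨l, hl⟩ := hG.exists_forall_le hcoer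
  have hbound : ε * ‖l‖ ^ 2 ≤ realDiv p k k₀ := by
    have h0 := hl 0
    have : G 0 = 0 := by simp [G, dualVal_zero p k hk₀]
    linarith [hlow l]
  refine ⟨l, l.2, fun h hh => ?_⟩
  have hq : HasDerivAt (fun t : ℝ => ε * ∑ z, ((l : X × Y → ℝ) + t • h) z ^ 2)
      (ε * ∑ z, 2 * (l : X × Y → ℝ) z * h z) 0 := by
    refine (HasDerivAt.fun_sum fun z _ => ?_).const_mul ε
    have hz : HasDerivAt (fun t : ℝ => ((l : X × Y → ℝ) + t • h) z) (h z) 0 := by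
      simpa using ((hasDerivAt_id (0 : ℝ)).mul_const (h z)).const_add ((l : X × Y → ℝ) z)
    simpa using hz.fun_pow 2
  have hder := hq.sub (hasDerivAt_dualVal p k hk₀_pos (l : X × Y → ℝ) h)
  have hmin : IsLocalMin ((fun t : ℝ => ε * ∑ z, ((l : X × Y → ℝ) + t • h) z ^ 2) -
      fun t : ℝ => dualVal p k k₀ ((l : X × Y → ℝ) + t • h)) 0 :=
    Filter.Eventually.of_forall fun t => by simpa [G] using hl (l + t • ⟨h, hh⟩)
  have hzero := hmin.hasDerivAt_eq_zero hder
  rw [← sub_eq_zero.1 hzero, abs_mul, abs_of_pos hε]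
  have h1 : |∑ z, 2 * (l : X × Y → ℝ) z * h z| ≤ 2 * ‖l‖ * ∑ z, |h z| := by
    rw [Finset.mul_sum]
    refine (Finset.abs_sum_le_sum_abs _ _).trans (Finset.sum_le_sum fun z _ => ?_)
    rw [abs_mul, abs_mul, abs_two]
    gcongr
    exact norm_le_pi_norm (l : X × Y → ℝ) z
  have h2 : ε * ‖l‖ ≤ √(ε * realDiv p k k₀) := by
    refine Real.le_sqrt_of_sq_le ?_
    nlinarith
  calc ε * |∑ z, 2 * (l : X × Y → ℝ) z * h z| ≤ ε * (2 * ‖l‖ * ∑ z, |h z|) := by gcongr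
    _ = 2 * (ε * ‖l‖) * ∑ z, |h z| := by ring
    _ ≤ _ := by gcongr

theorem nonempty_mixFam_inter_closure_expFam {L : Submodule ℝ (X × Y → ℝ)} {p : X → ℝ}
    (hp : ∀ x, 0 < p x) {k k₀ : X × Y → ℝ} (hk : IsChannel k) (hk₀ : IsChannel k₀)
    (hk₀_pos : ∀ z, 0 < k₀ z) :
    (mixFam p k L ∩ closure (expFam k₀ L)).Nonempty := by
  choose l hlL hl using fun n : ℕ =>
    exists_tilt_moment_le (L := L) hp hk hk₀ hk₀_pos (Nat.one_div_pos_of_nat (n := n) (α := ℝ))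
  obtain ⟨m₀, hm₀, φ, hφ, hlim⟩ :=
    isCompact_setOf_isChannel.tendsto_subseq fun n => isChannel_tilt hk₀_pos (l n)
  refine ⟨m₀, ⟨hm₀, fun h hh => ?_⟩, mem_closure_of_tendsto hlim
    (Filter.Eventually.of_forall fun n => ⟨_, hlL _, rfl⟩)⟩
  have hcont : Continuous fun m : X × Y → ℝ =>
      |∑ z, p z.1 * k z * h z - ∑ z, p z.1 * m z * h z| := by fun_prop
  have hbd : Filter.Tendsto (fun n : ℕ => 2 * √(1 / ((n : ℝ) + 1) * realDiv p k k₀) * ∑ z, |h z|)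
      Filter.atTop (nhds 0) := by
    simpa using (((tendsto_one_div_add_atTop_nhds_zero_nat (𝕜 := ℝ)).mul_const
      (realDiv p k k₀)).sqrt.const_mul 2).mul_const (∑ z, |h z|)
  have hle := le_of_tendsto_of_tendsto' ((hcont.tendsto m₀).comp hlim)
    (hbd.comp hφ.tendsto_atTop) fun n => hl (φ n) h hh
  exact (sub_eq_zero.1 (abs_nonpos_iff.1 hle)).symm

end

/-- **Duality (mixture side).** A channel `k'` lies in `M_p(k,L) ∩ cl(E(k₀,L))`
iff `k'` lies in `M_p(k,L)` and realizes the infimum of `D_p(·‖k₀)` over `M_p(k,L)`. -/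
theorem mem_mix_inter_exp_iff_Iproj
    {X Y : Type} [Fintype X] [Fintype Y] [Nonempty X] [Nonempty Y]
    (L : Submodule ℝ (X × Y → ℝ))
    (p : X → ℝ) (hp_pos : ∀ x, 0 < p x) (hp_sum : ∑ x, p x = 1)
    (k : X × Y → ℝ) (hk : IsChannel k)
    (k₀ : X × Y → ℝ) (hk₀ : IsChannel k₀) (hk₀_pos : ∀ z, 0 < k₀ z)
    (k' : X × Y → ℝ) (hk' : IsChannel k') :
    k' ∈ mixFam p k L ∩ closure (expFam k₀ L) ↔
      (k' ∈ mixFam p k L ∧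
        chanDiv p k' k₀ = ⨅ m ∈ mixFam p k L, chanDiv p m k₀) := by
  constructor
  · rintro ⟨hM, hE⟩
    refine ⟨hM, le_antisymm (le_iInf₂ fun m hm => ?_) (iInf₂_le k' hM)⟩
    rw [chanDiv_eq_ofReal_realDiv p _ hk₀_pos, chanDiv_eq_ofReal_realDiv p _ hk₀_pos]
    refine ENNReal.ofReal_le_ofReal ?_
    linarith [realDiv_add_hellSq_le hp_pos hk₀_pos hm hM hE, hellSq_nonneg hp_pos m k']
  · rintro ⟨hM, hinf⟩
    obtain ⟨m₀, hm₀, hcl⟩ :=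
      nonempty_mixFam_inter_closure_expFam (L := L) hp_pos hk hk₀ hk₀_pos
    have hle : chanDiv p k' k₀ ≤ chanDiv p m₀ k₀ := hinf.trans_le (iInf₂_le m₀ hm₀)
    rw [chanDiv_eq_ofReal_realDiv p _ hk₀_pos, chanDiv_eq_ofReal_realDiv p _ hk₀_pos,
      ENNReal.ofReal_le_ofReal_iff ((hellSq_nonneg hp_pos m₀ k₀).trans
        (hellSq_le_realDiv hp_pos hm₀.1 hk₀ hk₀_pos))] at hle
    have hpyth := realDiv_add_hellSq_le hp_pos hk₀_pos hM hm₀ hcl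
    have heq : k' = m₀ := eq_of_hellSq_le_zero hp_pos hk' hm₀.1 (by linarith)
    exact ⟨hM, heq ▸ hcl⟩
end

section
/- Let X, Y be nonempty finite sets, L a linear subspace of real-valued functions on X × Y, p a strictly positive probability distribution on X, k ∈ K(X;Y) a channel, and k₀ ∈ K(X;Y) a strictly positive channel. Suppose k' lies in both the mixture family M_p(k,L) and the closure of the exponential family E(k₀,L). Then for every m ∈ M_p(k,L) the Pythagorean identity D_p(m||k₀) = D_p(m||k') + D_p(k'||k₀) holds. -/
open scoped ENNReal BigOperators

open Filter Topology in
/-- Integrating `log (q / k₀)` against a weight supported in the support of `k'` is continuous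
in `q` at `k'`. -/
theorem tendsto_sum_mul_log_div {Z : Type} [Fintype Z] {k₀ k' : Z → ℝ}
    (hk₀ : ∀ z, 0 < k₀ z) (w : Z → ℝ) (hw : ∀ z, k' z = 0 → w z = 0)
    (s : Set (Z → ℝ)) :
    Tendsto (fun q : Z → ℝ => ∑ z, w z * Real.log (q z / k₀ z)) (𝓝[s] k')
      (𝓝 (∑ z, w z * Real.log (k' z / k₀ z))) := by
  refine tendsto_finsetSum _ fun z _ => ?_
  by_cases hz : k' z = 0
  · simpa [hw z hz] using tendsto_const_nhds
  · have hc : Tendsto (fun q : Z → ℝ => q z / k₀ z) (𝓝[s] k') (𝓝 (k' z / k₀ z)) :=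
      (((continuous_apply z).tendsto k').mono_left nhdsWithin_le_nhds).div_const _
    exact (hc.log (div_ne_zero hz (hk₀ z).ne')).const_mul _

section Channels

variable {X Y : Type} [Fintype Y]

theorem IsChannel.le_one {k : X × Y → ℝ} (hk : IsChannel k) (z : X × Y) : k z ≤ 1 := by
  rw [← hk.2 z.1]
  exact Finset.single_le_sum (f := fun y => k (z.1, y)) (fun y _ => hk.1 _) (Finset.mem_univ z.2)

theorem pos_of_mem_expFam {k₀ : X × Y → ℝ} (hk₀ : ∀ z, 0 < k₀ z)
    {L : Submodule ℝ (X × Y → ℝ)} {q : X × Y → ℝ} (hq : q ∈ expFam k₀ L) (z : X × Y) :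
    0 < q z := by
  obtain ⟨l, -, rfl⟩ := hq
  exact div_pos (mul_pos (Real.exp_pos _) (hk₀ z))
    (Finset.sum_pos (fun y _ => mul_pos (Real.exp_pos _) (hk₀ _)) ⟨z.2, Finset.mem_univ _⟩)

theorem isChannel_of_mem_expFam [Nonempty Y] {k₀ : X × Y → ℝ} (hk₀ : ∀ z, 0 < k₀ z)
    {L : Submodule ℝ (X × Y → ℝ)} {q : X × Y → ℝ} (hq : q ∈ expFam k₀ L) : IsChannel q := by
  refine ⟨fun z => (pos_of_mem_expFam hk₀ hq z).le, fun x => ?_⟩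
  obtain ⟨l, -, rfl⟩ := hq
  dsimp only
  rw [← Finset.sum_div]
  exact div_self (Finset.sum_pos (fun y _ => mul_pos (Real.exp_pos _) (hk₀ _))
    Finset.univ_nonempty).ne'

variable [Fintype X]

theorem IsChannel.sum_mul {k : X × Y → ℝ} (hk : IsChannel k) (g : X → ℝ) :
    ∑ z : X × Y, k z * g z.1 = ∑ x, g x := by
  rw [Fintype.sum_prod_type]
  refine Finset.sum_congr rfl fun x _ => ?_
  dsimp only
  rw [← Finset.sum_mul, hk.2 x, one_mul]

/-- **Gibbs' inequality** for channels. -/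
theorem IsChannel.sum_mul_log_div_nonneg {p : X → ℝ} (hp : ∀ x, 0 ≤ p x) {m q : X × Y → ℝ}
    (hm : IsChannel m) (hq : IsChannel q) (hmq : ∀ z, q z = 0 → m z = 0) :
    0 ≤ ∑ z : X × Y, p z.1 * m z * Real.log (m z / q z) := by
  have h0 : ∑ z : X × Y, p z.1 * (m z - q z) = 0 := by
    have h1 := hm.sum_mul p
    have h2 := hq.sum_mul p
    simp only [mul_comm (p _), sub_mul, Finset.sum_sub_distrib]
    linarith
  rw [← h0]
  refine Finset.sum_le_sum fun z _ => ?_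
  rw [mul_assoc]
  refine mul_le_mul_of_nonneg_left ?_ (hp z.1)
  rcases (hm.1 z).eq_or_lt with hz | hz
  · simpa [← hz] using hq.1 z
  · have hqz : 0 < q z := (hq.1 z).lt_of_ne fun h => hz.ne' (hmq z h.symm)
    have h := mul_le_mul_of_nonneg_left
      (Real.one_sub_inv_le_log_of_pos (div_pos hz hqz)) hz.le
    rwa [inv_div, mul_sub, mul_one, mul_div_cancel₀ _ hz.ne'] at h

/-- The log-density `log (q / k₀)` of a member `q` of the exponential family has the same
expectation under all members of the mixture family. -/
theorem sum_mul_log_div_eq_of_mem_expFam {p : X → ℝ} {k k₀ : X × Y → ℝ} (hk₀ : ∀ z, 0 < k₀ z)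
    {L : Submodule ℝ (X × Y → ℝ)} {q m m' : X × Y → ℝ} (hq : q ∈ expFam k₀ L)
    (hm : m ∈ mixFam p k L) (hm' : m' ∈ mixFam p k L) :
    ∑ z : X × Y, p z.1 * m z * Real.log (q z / k₀ z) =
      ∑ z : X × Y, p z.1 * m' z * Real.log (q z / k₀ z) := by
  obtain ⟨l, hl, rfl⟩ := hq
  set Z : X → ℝ := fun x => ∑ y : Y, Real.exp (l (x, y)) * k₀ (x, y) with hZ
  have hlog (z : X × Y) :
      Real.log (Real.exp (l z) * k₀ z / Z z.1 / k₀ z) = l z - Real.log (Z z.1) := by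
    have hpos : 0 < Z z.1 :=
      Finset.sum_pos (fun y _ => mul_pos (Real.exp_pos _) (hk₀ _)) ⟨z.2, Finset.mem_univ _⟩
    rw [div_right_comm, mul_div_cancel_right₀ _ (hk₀ z).ne',
      Real.log_div (Real.exp_pos _).ne' hpos.ne', Real.log_exp]
  have key {n : X × Y → ℝ} (hn : n ∈ mixFam p k L) :
      ∑ z : X × Y, p z.1 * n z * Real.log (Real.exp (l z) * k₀ z / Z z.1 / k₀ z) =
        ∑ z : X × Y, p z.1 * k z * l z - ∑ x, p x * Real.log (Z x) := by
    rw [← hn.2 l hl, ← hn.1.sum_mul fun x => p x * Real.log (Z x), ← Finset.sum_sub_distrib]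
    refine Finset.sum_congr rfl fun z _ => ?_
    rw [hlog]
    ring
  exact (key hm).trans (key hm').symm

open Filter Topology in
/-- Members of the mixture family are supported in the support of any member of the mixture
family that is a limit of the exponential family. -/
theorem eq_zero_of_mem_closure_expFam [Nonempty Y] {p : X → ℝ} (hp : ∀ x, 0 < p x)
    {k k₀ k' m : X × Y → ℝ} (hk₀ : ∀ z, 0 < k₀ z) {L : Submodule ℝ (X × Y → ℝ)}
    (hk'M : k' ∈ mixFam p k L) (hk'E : k' ∈ closure (expFam k₀ L)) (hm : m ∈ mixFam p k L)
    {z : X × Y} (hz : k' z = 0) : m z = 0 := by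
  by_contra hmz
  have hw : 0 < p z.1 * m z := mul_pos (hp _) ((hm.1.1 z).lt_of_ne' hmz)
  have := mem_closure_iff_nhdsWithin_neBot.1 hk'E
  have hmem : ∀ᶠ q in 𝓝[expFam k₀ L] k', q ∈ expFam k₀ L := self_mem_nhdsWithin
  have hlim := tendsto_sum_mul_log_div (k' := k') hk₀ (fun z => p z.1 * k' z)
    (fun z h => by simp [h]) (expFam k₀ L)
  have hzero : Tendsto (fun q : X × Y → ℝ => q z) (𝓝[expFam k₀ L] k') (𝓝[≠] 0) := by
    refine tendsto_nhdsWithin_iff.2 ⟨?_, hmem.mono fun q hq => (pos_of_mem_expFam hk₀ hq z).ne'⟩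
    simpa only [hz] using ((continuous_apply z).tendsto k').mono_left nhdsWithin_le_nhds
  have hbot := (Real.tendsto_log_nhdsNE_zero.comp hzero).const_mul_atBot hw
  refine not_tendsto_nhds_of_tendsto_atBot
    (tendsto_atBot_mono' _ ?_ (tendsto_atBot_add_const_right _
      (-∑ z : X × Y, p z.1 * m z * Real.log (k₀ z)) hbot)) _ hlim
  filter_upwards [hmem] with q hq
  have hqc := isChannel_of_mem_expFam hk₀ hq
  have hsplit : ∑ z : X × Y, p z.1 * m z * Real.log (q z / k₀ z) =
      ∑ z : X × Y, p z.1 * m z * Real.log (q z) -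
        ∑ z : X × Y, p z.1 * m z * Real.log (k₀ z) := by
    rw [← Finset.sum_sub_distrib]
    refine Finset.sum_congr rfl fun z _ => ?_
    rw [Real.log_div (pos_of_mem_expFam hk₀ hq z).ne' (hk₀ z).ne', mul_sub]
  have hterm : ∑ z : X × Y, p z.1 * m z * Real.log (q z) ≤ p z.1 * m z * Real.log (q z) := by
    have := Finset.single_le_sum (f := fun z : X × Y => -(p z.1 * m z * Real.log (q z)))
      (fun z _ => neg_nonneg.2 (mul_nonpos_of_nonneg_of_nonpos
        (mul_nonneg (hp _).le (hm.1.1 z)) (Real.log_nonpos (hqc.1 z) (hqc.le_one z))))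
      (Finset.mem_univ z)
    rw [Finset.sum_neg_distrib] at this
    exact neg_le_neg_iff.1 this
  rw [sum_mul_log_div_eq_of_mem_expFam hk₀ hq hk'M hm, hsplit, sub_eq_add_neg]
  exact add_le_add_left hterm _

theorem chanDiv_eq_ofReal {p : X → ℝ} {m q : X × Y → ℝ} (hmq : ∀ z, q z = 0 → m z = 0) :
    chanDiv p m q = ENNReal.ofReal (∑ z : X × Y, p z.1 * m z * Real.log (m z / q z)) :=
  if_pos fun z hz hqz => hz (by rw [hmq z hqz, mul_zero])

end Channels

/-- **Pythagorean identity (mixture side).** If `k'` lies in both `M_p(k,L)` and the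
closure of `E(k₀,L)`, then `D_p(m‖k₀) = D_p(m‖k') + D_p(k'‖k₀)` for every `m ∈ M_p(k,L)`. -/
theorem pythagorean_mixFam
    {X Y : Type} [Fintype X] [Fintype Y] [Nonempty X] [Nonempty Y]
    (L : Submodule ℝ (X × Y → ℝ))
    (p : X → ℝ) (hp_pos : ∀ x, 0 < p x) (hp_sum : ∑ x, p x = 1)
    (k : X × Y → ℝ) (hk : IsChannel k)
    (k₀ : X × Y → ℝ) (hk₀ : IsChannel k₀) (hk₀_pos : ∀ z, 0 < k₀ z)
    (k' : X × Y → ℝ) (hk'M : k' ∈ mixFam p k L) (hk'E : k' ∈ closure (expFam k₀ L)) :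
    ∀ m ∈ mixFam p k L,
      chanDiv p m k₀ = chanDiv p m k' + chanDiv p k' k₀ := by
  intro m hm
  have hsupp (z : X × Y) (hz : k' z = 0) : m z = 0 :=
    eq_zero_of_mem_closure_expFam hp_pos hk₀_pos hk'M hk'E hm hz
  have hsupp₀ (n : X × Y → ℝ) (z : X × Y) (hz : k₀ z = 0) : n z = 0 :=
    absurd hz (hk₀_pos z).ne'
  have hp (x : X) : 0 ≤ p x := (hp_pos x).le
  have := mem_closure_iff_nhdsWithin_neBot.1 hk'E
  have heq : ∑ z : X × Y, p z.1 * m z * Real.log (k' z / k₀ z) =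
      ∑ z : X × Y, p z.1 * k' z * Real.log (k' z / k₀ z) := by
    have h₁ := tendsto_sum_mul_log_div (k' := k') hk₀_pos (fun z => p z.1 * m z)
      (fun z h => by simp [hsupp z h]) (expFam k₀ L)
    have h₂ := tendsto_sum_mul_log_div (k' := k') hk₀_pos (fun z => p z.1 * k' z)
      (fun z h => by simp [h]) (expFam k₀ L)
    refine tendsto_nhds_unique_of_eventuallyEq h₁ h₂ ?_
    filter_upwards [self_mem_nhdsWithin] with q hq
    exact sum_mul_log_div_eq_of_mem_expFam hk₀_pos hq hm hk'M
  rw [chanDiv_eq_ofReal (hsupp₀ m), chanDiv_eq_ofReal hsupp, chanDiv_eq_ofReal (hsupp₀ k'),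
    ← ENNReal.ofReal_add (hm.1.sum_mul_log_div_nonneg hp hk'M.1 hsupp)
      (hk'M.1.sum_mul_log_div_nonneg hp hk₀ (hsupp₀ k')), ← heq, ← Finset.sum_add_distrib]
  congr 1
  refine Finset.sum_congr rfl fun z _ => ?_
  by_cases hz : m z = 0
  · simp [hz]
  · have hz' : k' z ≠ 0 := fun h => hz (hsupp z h)
    rw [← mul_add, ← Real.log_mul (div_ne_zero hz hz') (div_ne_zero hz' (hk₀_pos z).ne'),
      div_mul_div_cancel₀ hz']
end

section
/- Let X = ∏_{i∈V} X_i and Y = ∏_{j∈W} Y_j be finite products of nonempty finite sets, p a strictly positive probability distribution on X, and k̄ ∈ K(X;Y) a strictly positive channel. For 1 ≤ i ≤ n let I_i ⊆ V and let J_i ⊆ W be nonempty, and let M_i be the set of channels k with p(x_{I_i}) k(x_{I_i}; y_{J_i}) = p(x_{I_i}) k̄(x_{I_i}; y_{J_i}) for all arguments; set M := ∩_i M_i. Let k⁰ ∈ K(X;Y) be a strictly positive channel, and define the sequence k^j := Nσ_{I_{(j mod n)} J_{(j mod n)}}^{k̄} k^{j−1} of normalized IJ-scalings (always prescribing the corresponding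 marginal of k̄). Then the sequence (k^j) converges to a channel l ∈ M. -/
open scoped BigOperators ENNReal

variable {N M : ℕ} {X : Fin N → Type} {Y : Fin M → Type}

/-- Restriction of a configuration to the coordinates in `I`. -/
def restr (I : Finset (Fin N)) (x : ∀ i, X i) : ∀ i : I, X i.1 :=
  fun i => x i.1

/-- The `X_I`-marginal `p(x_I)` of a distribution `p` on `X = ∏ᵢ Xᵢ`. -/
def margP [∀ i, Fintype (X i)] [∀ i, DecidableEq (X i)]
    (p : (∀ i, X i) → ℝ) (I : Finset (Fin N)) (ξ : ∀ i : I, X i.1) : ℝ :=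
  ∑ x : ∀ i, X i, if restr I x = ξ then p x else 0

/-- The channel marginal `k(x_I; y_J) = ∑_{x_{Iᶜ}, y_{Jᶜ}} p(x_{Iᶜ}|x_I) k(x;y)`,
taken with respect to the input distribution `p`. -/
noncomputable def margK [∀ i, Fintype (X i)] [∀ i, DecidableEq (X i)]
    [∀ j, Fintype (Y j)] [∀ j, DecidableEq (Y j)]
    (p : (∀ i, X i) → ℝ) (k : (∀ i, X i) → (∀ j, Y j) → ℝ)
    (I : Finset (Fin N)) (J : Finset (Fin M))
    (ξ : ∀ i : I, X i.1) (η : ∀ j : J, Y j.1) : ℝ :=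
  ∑ x : ∀ i, X i, ∑ y : ∀ j, Y j,
    if restr I x = ξ ∧ restr J y = η then (p x / margP p I ξ) * k x y else 0

/-- The `(X_I, Y_J)`-marginal `pk(x_I, y_J)` of the joint distribution
`pk(x,y) = p(x) k(x;y)`. -/
def margJoint [∀ i, Fintype (X i)] [∀ i, DecidableEq (X i)]
    [∀ j, Fintype (Y j)] [∀ j, DecidableEq (Y j)]
    (p : (∀ i, X i) → ℝ) (k : (∀ i, X i) → (∀ j, Y j) → ℝ)
    (I : Finset (Fin N)) (J : Finset (Fin M))
    (ξ : ∀ i : I, X i.1) (η : ∀ j : J, Y j.1) : ℝ :=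
  ∑ x : ∀ i, X i, ∑ y : ∀ j, Y j,
    if restr I x = ξ ∧ restr J y = η then p x * k x y else 0

/-- The unnormalized `IJ`-scaling of a channel,
`σ_{IJ}^{k̄} k (x,y) = k(x;y) · k̄(x_I;y_J) / k(x_I;y_J)`. -/
noncomputable def chScale [∀ i, Fintype (X i)] [∀ i, DecidableEq (X i)]
    [∀ j, Fintype (Y j)] [∀ j, DecidableEq (Y j)]
    (p : (∀ i, X i) → ℝ) (k : (∀ i, X i) → (∀ j, Y j) → ℝ)
    (I : Finset (Fin N)) (J : Finset (Fin M))
    (kbar : (∀ i : I, X i.1) → (∀ j : J, Y j.1) → ℝ)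
    (x : ∀ i, X i) (y : ∀ j, Y j) : ℝ :=
  k x y * kbar (restr I x) (restr J y) / margK p k I J (restr I x) (restr J y)

/-- The normalized `IJ`-scaling `Nσ_{IJ}^{k̄} k (x,y) = σ_{IJ}^{k̄} k (x,y) / Z(x)`,
with `Z(x) = ∑_{y'} σ_{IJ}^{k̄} k (x,y')`. -/
noncomputable def chScaleN [∀ i, Fintype (X i)] [∀ i, DecidableEq (X i)]
    [∀ j, Fintype (Y j)] [∀ j, DecidableEq (Y j)]
    (p : (∀ i, X i) → ℝ) (k : (∀ i, X i) → (∀ j, Y j) → ℝ)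
    (I : Finset (Fin N)) (J : Finset (Fin M))
    (kbar : (∀ i : I, X i.1) → (∀ j : J, Y j.1) → ℝ)
    (x : ∀ i, X i) (y : ∀ j, Y j) : ℝ :=
  chScale p k I J kbar x y / ∑ y', chScale p k I J kbar x y'

/-- The iterative-scaling sequence: `k⁰` is the starting channel, and
`k^j = Nσ_{I_{(j mod n)} J_{(j mod n)}}^{k̄} k^{j-1}`, where the prescribed marginal is
the `(I_i, J_i)`-marginal of `k̄`. -/
noncomputable def scaleSeq [∀ i, Fintype (X i)] [∀ i, DecidableEq (X i)]
    [∀ j, Fintype (Y j)] [∀ j, DecidableEq (Y j)]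
    (p : (∀ i, X i) → ℝ) (kbar : (∀ i, X i) → (∀ j, Y j) → ℝ)
    {n : ℕ} (Is : Fin n → Finset (Fin N)) (Js : Fin n → Finset (Fin M))
    (hn : 0 < n) (k0 : (∀ i, X i) → (∀ j, Y j) → ℝ) :
    ℕ → (∀ i, X i) → (∀ j, Y j) → ℝ
  | 0 => k0
  | j + 1 =>
    let i : Fin n := ⟨(j + 1) % n, Nat.mod_lt _ hn⟩
    chScaleN p (scaleSeq p kbar Is Js hn k0 j) (Is i) (Js i)
      (margK p kbar (Is i) (Js i))

section FiberScaling

open Filter Topology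

variable {A B T ι : Type*} [Fintype A] [Fintype B]

/-- The mass that the joint distribution `p(x) k(x;y)` gives to the fiber of `f` over `t`. -/
def fiberMass [DecidableEq T] (p : A → ℝ) (f : A → B → T) (k : A → B → ℝ) (t : T) : ℝ :=
  ∑ x, ∑ y, if f x y = t then p x * k x y else 0

/-- The factor by which the entry `(x, y)` is multiplied when the fiber masses of `k` are
scaled to those of `kbar`. -/
noncomputable def fiberRatio [DecidableEq T] (p : A → ℝ) (f : A → B → T) (kbar k : A → B → ℝ)
    (x : A) (y : B) : ℝ :=
  fiberMass p f kbar (f x y) / fiberMass p f k (f x y)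

/-- Scaling of the fiber masses followed by normalization of every row. -/
noncomputable def fiberScale [DecidableEq T] (p : A → ℝ) (f : A → B → T) (kbar k : A → B → ℝ)
    (x : A) (y : B) : ℝ :=
  k x y * fiberRatio p f kbar k x y / ∑ y', k x y' * fiberRatio p f kbar k x y'

/-- The divergence `∑ p(x) u(x;y) log (u(x;y) / k(x;y))`. -/
noncomputable def channelDiv (p : A → ℝ) (u k : A → B → ℝ) : ℝ :=
  ∑ x, ∑ y, p x * (u x y * (Real.log (u x y) - Real.log (k x y)))

lemma sq_sqrt_sub_sqrt_le {a b : ℝ} (ha : 0 ≤ a) (hb : 0 < b) :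
    (√a - √b) ^ 2 ≤ a * (Real.log a - Real.log b) - a + b := by
  rcases ha.eq_or_lt with rfl | ha
  · simp [Real.sq_sqrt hb.le]
  have hsa := Real.sqrt_pos.2 ha
  have hsb := Real.sqrt_pos.2 hb
  have h := Real.log_le_sub_one_of_pos (div_pos hsb hsa)
  rw [Real.log_div hsb.ne' hsa.ne', Real.log_sqrt ha.le, Real.log_sqrt hb.le] at h
  have h2 := mul_le_mul_of_nonneg_left h ha.le
  have h3 : a * (√b / √a - 1) = √a * √b - a := by
    calc a * (√b / √a - 1) = a / √a * √b - a := by ring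
      _ = √a * √b - a := by rw [Real.div_sqrt]
  rw [h3] at h2
  nlinarith [Real.sq_sqrt ha.le, Real.sq_sqrt hb.le]

lemma tendsto_of_sq_sqrt_sub_sqrt {l : Filter ι} {a : ℝ} {b h : ι → ℝ} (ha : 0 ≤ a)
    (hb : ∀ i, 0 ≤ b i) (hle : ∀ᶠ i in l, (√a - √(b i)) ^ 2 ≤ h i) (hh : Tendsto h l (𝓝 0)) :
    Tendsto b l (𝓝 a) := by
  have h1 : Tendsto (fun i => (√a - √(b i)) ^ 2) l (𝓝 0) :=
    tendsto_of_tendsto_of_tendsto_of_le_of_le' tendsto_const_nhds hh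
      (Eventually.of_forall fun i => sq_nonneg _) hle
  have h2 : Tendsto (fun i => |√a - √(b i)|) l (𝓝 0) := by
    simpa [Real.sqrt_sq_eq_abs] using h1.sqrt
  have h3 : Tendsto (fun i => √a - √(b i)) l (𝓝 0) :=
    (tendsto_zero_iff_abs_tendsto_zero _).2 h2
  have h4 : Tendsto (fun i => (√a - (√a - √(b i))) ^ 2) l (𝓝 ((√a - 0) ^ 2)) :=
    (tendsto_const_nhds.sub h3).pow 2
  simpa [Real.sq_sqrt, ha, hb] using h4

lemma tendsto_of_finite_cases [Finite ι] {E : Type*} [TopologicalSpace E] {e : E} {l : Filter ℕ}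
    (s : ℕ → ι) (g : ι → ℕ → E)
    (h : ∀ i, Tendsto (g i) (l ⊓ 𝓟 {j | s j = i}) (𝓝 e)) :
    Tendsto (fun j => g (s j) j) l (𝓝 e) := by
  intro U hU
  have h1 : ∀ i, ∀ᶠ j in l, s j = i → g i j ∈ U := fun i =>
    eventually_inf_principal.1 (h i hU)
  exact (eventually_all.2 h1).mono fun j hj => hj _ rfl

lemma le_one_of_sum_eq_one {v : B → ℝ} (hv : ∀ y, 0 < v y) (hv1 : ∑ y, v y = 1) (y : B) :
    v y ≤ 1 :=
  hv1 ▸ Finset.single_le_sum (fun y _ => (hv y).le) (Finset.mem_univ y)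

section FiberMass

variable [DecidableEq T] {p : A → ℝ} {f : A → B → T} {k kbar u : A → B → ℝ}

lemma sum_mul_comp_eq_sum_fiberMass [Fintype T] (p : A → ℝ) (f : A → B → T) (k : A → B → ℝ)
    (g : T → ℝ) : ∑ x, ∑ y, p x * k x y * g (f x y) = ∑ t, fiberMass p f k t * g t := by
  simp_rw [fiberMass, Finset.sum_mul]
  conv_rhs => rw [Finset.sum_comm]
  refine Finset.sum_congr rfl fun x _ => ?_
  conv_rhs => rw [Finset.sum_comm]
  refine Finset.sum_congr rfl fun y _ => ?_
  simp [ite_mul]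

lemma fiberMass_nonneg (hp : ∀ x, 0 < p x) (hk : ∀ x y, 0 ≤ k x y) (t : T) :
    0 ≤ fiberMass p f k t := by
  refine Finset.sum_nonneg fun x _ => Finset.sum_nonneg fun y _ => ?_
  split_ifs
  · exact mul_nonneg (hp x).le (hk x y)
  · exact le_rfl

lemma fiberMass_pos (hp : ∀ x, 0 < p x) (hk : ∀ x y, 0 < k x y) (x : A) (y : B) :
    0 < fiberMass p f k (f x y) := by
  have h0 : ∀ x' y', 0 ≤ if f x' y' = f x y then p x' * k x' y' else 0 := fun x' y' => by
    split_ifs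
    · exact (mul_pos (hp x') (hk x' y')).le
    · exact le_rfl
  refine Finset.sum_pos' (fun x' _ => Finset.sum_nonneg fun y' _ => h0 x' y')
    ⟨x, Finset.mem_univ _, Finset.sum_pos' (fun y' _ => h0 x y') ⟨y, Finset.mem_univ _, ?_⟩⟩
  simpa using mul_pos (hp x) (hk x y)

lemma fiberMass_mul_div (hp : ∀ x, 0 < p x) (hk : ∀ x y, 0 < k x y) (t : T) :
    fiberMass p f k t * (fiberMass p f kbar t / fiberMass p f k t) = fiberMass p f kbar t := by
  by_cases h : ∃ x y, f x y = t
  · obtain ⟨x, y, rfl⟩ := h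
    exact mul_div_cancel₀ _ (fiberMass_pos hp hk x y).ne'
  · push Not at h
    simp [fiberMass, h]

lemma sum_fiberMass [Fintype T] (hp1 : ∑ x, p x = 1) (hk1 : ∀ x, ∑ y, k x y = 1) :
    ∑ t, fiberMass p f k t = 1 := by
  have h := sum_mul_comp_eq_sum_fiberMass p f k fun _ => 1
  simp only [mul_one] at h
  rw [← h]
  simp [← Finset.mul_sum, hk1, hp1]

lemma fiberRatio_pos (hp : ∀ x, 0 < p x) (hkbar : ∀ x y, 0 < kbar x y) (hk : ∀ x y, 0 < k x y)
    (x : A) (y : B) : 0 < fiberRatio p f kbar k x y :=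
  div_pos (fiberMass_pos hp hkbar x y) (fiberMass_pos hp hk x y)

lemma sum_mul_fiberRatio_pos [Nonempty B] (hp : ∀ x, 0 < p x) (hkbar : ∀ x y, 0 < kbar x y)
    (hk : ∀ x y, 0 < k x y) (x : A) : 0 < ∑ y, k x y * fiberRatio p f kbar k x y :=
  Finset.sum_pos (fun y _ => mul_pos (hk x y) (fiberRatio_pos hp hkbar hk x y))
    Finset.univ_nonempty

lemma fiberScale_pos [Nonempty B] (hp : ∀ x, 0 < p x) (hkbar : ∀ x y, 0 < kbar x y)
    (hk : ∀ x y, 0 < k x y) (x : A) (y : B) : 0 < fiberScale p f kbar k x y :=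
  div_pos (mul_pos (hk x y) (fiberRatio_pos hp hkbar hk x y))
    (sum_mul_fiberRatio_pos hp hkbar hk x)

lemma sum_fiberScale [Nonempty B] (hp : ∀ x, 0 < p x) (hkbar : ∀ x y, 0 < kbar x y)
    (hk : ∀ x y, 0 < k x y) (x : A) : ∑ y, fiberScale p f kbar k x y = 1 := by
  simp only [fiberScale]
  rw [← Finset.sum_div, div_self (sum_mul_fiberRatio_pos hp hkbar hk x).ne']

lemma sum_mul_sum_mul_fiberRatio [Fintype T] (hp : ∀ x, 0 < p x) (hk : ∀ x y, 0 < k x y)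
    (hp1 : ∑ x, p x = 1) (hkbar1 : ∀ x, ∑ y, kbar x y = 1) :
    ∑ x, p x * ∑ y, k x y * fiberRatio p f kbar k x y = 1 := by
  have h := sum_mul_comp_eq_sum_fiberMass p f k
    fun t => fiberMass p f kbar t / fiberMass p f k t
  simp_rw [fiberMass_mul_div hp hk, sum_fiberMass hp1 hkbar1] at h
  simp_rw [Finset.mul_sum, ← mul_assoc]
  exact h

lemma sum_sq_sqrt_sub_sqrt_le_channelDiv (hp : ∀ x, 0 < p x) (hu : ∀ x y, 0 ≤ u x y)
    (hu1 : ∀ x, ∑ y, u x y = 1) (hk : ∀ x y, 0 < k x y) (hk1 : ∀ x, ∑ y, k x y = 1) :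
    ∑ x, ∑ y, p x * (√(u x y) - √(k x y)) ^ 2 ≤ channelDiv p u k := by
  refine Finset.sum_le_sum fun x _ => ?_
  rw [← Finset.mul_sum, ← Finset.mul_sum]
  refine mul_le_mul_of_nonneg_left ?_ (hp x).le
  calc ∑ y, (√(u x y) - √(k x y)) ^ 2
      ≤ ∑ y, (u x y * (Real.log (u x y) - Real.log (k x y)) - u x y + k x y) :=
        Finset.sum_le_sum fun y _ => sq_sqrt_sub_sqrt_le (hu x y) (hk x y)
    _ = ∑ y, u x y * (Real.log (u x y) - Real.log (k x y)) := by
        rw [Finset.sum_add_distrib, Finset.sum_sub_distrib, hu1, hk1]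
        ring

lemma mul_sq_sqrt_sub_sqrt_le_channelDiv (hp : ∀ x, 0 < p x) (hu : ∀ x y, 0 ≤ u x y)
    (hu1 : ∀ x, ∑ y, u x y = 1) (hk : ∀ x y, 0 < k x y) (hk1 : ∀ x, ∑ y, k x y = 1)
    (x : A) (y : B) : p x * (√(u x y) - √(k x y)) ^ 2 ≤ channelDiv p u k := by
  have h0 : ∀ x y, 0 ≤ p x * (√(u x y) - √(k x y)) ^ 2 := fun x y =>
    mul_nonneg (hp x).le (sq_nonneg _)
  refine le_trans ?_ (sum_sq_sqrt_sub_sqrt_le_channelDiv hp hu hu1 hk hk1)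
  exact (Finset.single_le_sum (fun y _ => h0 x y) (Finset.mem_univ y)).trans
    (Finset.single_le_sum (f := fun x => ∑ y, p x * (√(u x y) - √(k x y)) ^ 2)
      (fun x _ => Finset.sum_nonneg fun y _ => h0 x y) (Finset.mem_univ x))

lemma channelDiv_nonneg (hp : ∀ x, 0 < p x) (hu : ∀ x y, 0 ≤ u x y)
    (hu1 : ∀ x, ∑ y, u x y = 1) (hk : ∀ x y, 0 < k x y) (hk1 : ∀ x, ∑ y, k x y = 1) :
    0 ≤ channelDiv p u k :=
  (Finset.sum_nonneg fun x _ => Finset.sum_nonneg fun _ _ =>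
    mul_nonneg (hp x).le (sq_nonneg _)).trans
    (sum_sq_sqrt_sub_sqrt_le_channelDiv hp hu hu1 hk hk1)

/-- A scaling step decreases the divergence from any channel with the prescribed fiber masses
by at least the squared Hellinger distance of the fiber masses. -/
lemma sum_sq_le_channelDiv_sub_channelDiv_fiberScale [Fintype T] [Nonempty B]
    (hp : ∀ x, 0 < p x)
    (hp1 : ∑ x, p x = 1) (hkbar : ∀ x y, 0 < kbar x y) (hkbar1 : ∀ x, ∑ y, kbar x y = 1)
    (hk : ∀ x y, 0 < k x y) (hk1 : ∀ x, ∑ y, k x y = 1)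
    (hu1 : ∀ x, ∑ y, u x y = 1) (hm : ∀ t, fiberMass p f u t = fiberMass p f kbar t) :
    ∑ t, (√(fiberMass p f kbar t) - √(fiberMass p f k t)) ^ 2
      ≤ channelDiv p u k - channelDiv p u (fiberScale p f kbar k) := by
  set Z : A → ℝ := fun x => ∑ y, k x y * fiberRatio p f kbar k x y with hZ
  have hZpos : ∀ x, 0 < Z x := sum_mul_fiberRatio_pos hp hkbar hk
  have hlog : ∀ x y, Real.log (fiberScale p f kbar k x y)
      = Real.log (k x y) + (Real.log (fiberMass p f kbar (f x y))
        - Real.log (fiberMass p f k (f x y))) - Real.log (Z x) := fun x y => by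
    have h1 := fiberRatio_pos (f := f) hp hkbar hk x y
    rw [fiberScale, Real.log_div (mul_pos (hk x y) h1).ne' (hZpos x).ne',
      Real.log_mul (hk x y).ne' h1.ne', fiberRatio,
      Real.log_div (fiberMass_pos hp hkbar x y).ne' (fiberMass_pos hp hk x y).ne']
  have hdiff : channelDiv p u k - channelDiv p u (fiberScale p f kbar k)
      = ∑ t, fiberMass p f kbar t * (Real.log (fiberMass p f kbar t)
        - Real.log (fiberMass p f k t)) - ∑ x, p x * Real.log (Z x) := by
    have h1 := sum_mul_comp_eq_sum_fiberMass p f u fun t =>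
      Real.log (fiberMass p f kbar t) - Real.log (fiberMass p f k t)
    simp_rw [hm] at h1
    have h2 : ∑ x, p x * Real.log (Z x) = ∑ x, ∑ y, p x * u x y * Real.log (Z x) := by
      refine Finset.sum_congr rfl fun x _ => ?_
      rw [← Finset.sum_mul, ← Finset.mul_sum, hu1, mul_one]
    rw [← h1, h2, channelDiv, channelDiv]
    simp_rw [← Finset.sum_sub_distrib]
    refine Finset.sum_congr rfl fun x _ => Finset.sum_congr rfl fun y _ => ?_
    rw [hlog]
    ring
  have hlogZ : ∑ x, p x * Real.log (Z x) ≤ 0 :=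
    calc ∑ x, p x * Real.log (Z x) ≤ ∑ x, p x * (Z x - 1) :=
          Finset.sum_le_sum fun x _ => mul_le_mul_of_nonneg_left
            (Real.log_le_sub_one_of_pos (hZpos x)) (hp x).le
      _ = 0 := by
          simp_rw [mul_sub, mul_one, Finset.sum_sub_distrib, hZ,
            sum_mul_sum_mul_fiberRatio hp hk hp1 hkbar1, hp1, sub_self]
  have hterm : ∀ t, (√(fiberMass p f kbar t) - √(fiberMass p f k t)) ^ 2
      ≤ fiberMass p f kbar t * (Real.log (fiberMass p f kbar t)
        - Real.log (fiberMass p f k t)) - fiberMass p f kbar t + fiberMass p f k t := fun t => by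
    by_cases h : ∃ x y, f x y = t
    · obtain ⟨x, y, rfl⟩ := h
      exact sq_sqrt_sub_sqrt_le (fiberMass_pos hp hkbar x y).le (fiberMass_pos hp hk x y)
    · push Not at h
      simp [fiberMass, h]
  have hsum := Finset.sum_le_sum fun t (_ : t ∈ Finset.univ) => hterm t
  rw [Finset.sum_add_distrib, Finset.sum_sub_distrib, sum_fiberMass hp1 hkbar1,
    sum_fiberMass hp1 hk1] at hsum
  rw [hdiff]
  linarith

lemma continuous_fiberMass (p : A → ℝ) (f : A → B → T) (t : T) :
    Continuous fun k : A → B → ℝ => fiberMass p f k t := by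
  refine continuous_finsetSum _ fun x _ => continuous_finsetSum _ fun y _ => ?_
  split_ifs
  · fun_prop
  · fun_prop

lemma fiberMass_sub (p : A → ℝ) (f : A → B → T) (k u : A → B → ℝ) (t : T) :
    fiberMass p f (k - u) t = fiberMass p f k t - fiberMass p f u t := by
  simp_rw [fiberMass, ← Finset.sum_sub_distrib]
  refine Finset.sum_congr rfl fun x _ => Finset.sum_congr rfl fun y _ => ?_
  split_ifs
  · simp [mul_sub]
  · simp

lemma tendsto_fiberScale_sub {l : Filter ι} {K : ι → A → B → ℝ}
    (hp : ∀ x, 0 < p x) (hkbar : ∀ x y, 0 < kbar x y)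
    (hK : ∀ j x y, 0 < K j x y) (hK1 : ∀ j x, ∑ y, K j x y = 1)
    (h : ∀ t, Tendsto (fun j => fiberMass p f (K j) t) l (𝓝 (fiberMass p f kbar t))) :
    Tendsto (fun j => fiberScale p f kbar (K j) - K j) l (𝓝 0) := by
  have hR : ∀ x y, Tendsto (fun j => fiberRatio p f kbar (K j) x y) l (𝓝 1) := fun x y => by
    have hpos := (fiberMass_pos (f := f) hp hkbar x y).ne'
    have h1 := (tendsto_const_nhds (x := fiberMass p f kbar (f x y))).div (h (f x y)) hpos
    rwa [div_self hpos] at h1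
  have hbdd : ∀ x y, IsBoundedUnder (· ≤ ·) l (norm ∘ fun j => K j x y) := fun x y =>
    isBoundedUnder_of ⟨1, fun j => by
      simpa [abs_of_pos (hK j x y)] using le_one_of_sum_eq_one (hK j x) (hK1 j x) y⟩
  have hmul : ∀ x y {g : ι → ℝ}, Tendsto g l (𝓝 0) →
      Tendsto (fun j => K j x y * g j) l (𝓝 0) := fun x y g hg =>
    isBoundedUnder_le_mul_tendsto_zero (hbdd x y) hg
  have hZ : ∀ x, Tendsto (fun j => ∑ y, K j x y * fiberRatio p f kbar (K j) x y) l (𝓝 1) := by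
    intro x
    have h1 : Tendsto (fun j => ∑ y, K j x y * (fiberRatio p f kbar (K j) x y - 1)) l
        (𝓝 (∑ _y : B, 0)) :=
      tendsto_finsetSum _ fun y _ => hmul x y (by simpa using (hR x y).sub_const 1)
    have h2 := h1.add_const 1
    simpa [mul_sub, hK1] using h2
  rw [tendsto_pi_nhds]
  intro x
  rw [tendsto_pi_nhds]
  intro y
  have h1 := (hR x y).div (hZ x) one_ne_zero
  have h2 := hmul x y (by simpa using h1.sub_const 1)
  refine h2.congr fun j => ?_
  simp only [fiberScale, Pi.sub_apply]
  ring

end FiberMass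

/-- Cyclic iterated scaling of fiber masses converges to a channel with the prescribed fiber
masses. -/
theorem exists_tendsto_fiberScale_iterate [Nonempty B] {n : ℕ} (hn : 0 < n) {S : Fin n → Type*}
    [∀ i, Fintype (S i)] [∀ i, DecidableEq (S i)] (f : ∀ i, A → B → S i)
    {p : A → ℝ} {kbar : A → B → ℝ} {K : ℕ → A → B → ℝ}
    (hp : ∀ x, 0 < p x) (hp1 : ∑ x, p x = 1)
    (hkbar : ∀ x y, 0 < kbar x y) (hkbar1 : ∀ x, ∑ y, kbar x y = 1)
    (hK0 : ∀ x y, 0 < K 0 x y) (hK01 : ∀ x, ∑ y, K 0 x y = 1)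
    (hstep : ∀ j, K (j + 1) = fiberScale p (f ⟨(j + 1) % n, Nat.mod_lt _ hn⟩) kbar (K j)) :
    ∃ l : A → B → ℝ, ((∀ x y, 0 ≤ l x y) ∧ ∀ x, ∑ y, l x y = 1) ∧
      (∀ i t, fiberMass p (f i) l t = fiberMass p (f i) kbar t) ∧
      ∀ x y, Tendsto (fun j => K j x y) atTop (𝓝 (l x y)) := by
  set s : ℕ → Fin n := fun j => ⟨(j + 1) % n, Nat.mod_lt _ hn⟩
  have hK : ∀ j x y, 0 < K j x y := fun j => by
    induction j with
    | zero => exact hK0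
    | succ j ih => rw [hstep]; exact fiberScale_pos hp hkbar ih
  have hK1 : ∀ j x, ∑ y, K j x y = 1 := fun j => by
    cases j with
    | zero => exact hK01
    | succ j => rw [hstep]; exact sum_fiberScale hp hkbar (hK j)
  have hdesc : ∀ u : A → B → ℝ, (∀ x, ∑ y, u x y = 1) →
      (∀ i t, fiberMass p (f i) u t = fiberMass p (f i) kbar t) → ∀ j,
      ∑ t, (√(fiberMass p (f (s j)) kbar t) - √(fiberMass p (f (s j)) (K j) t)) ^ 2
        ≤ channelDiv p u (K j) - channelDiv p u (K (j + 1)) := fun u hu1 hm j => by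
    rw [hstep]
    exact sum_sq_le_channelDiv_sub_channelDiv_fiberScale hp hp1 hkbar hkbar1 (hK j) (hK1 j)
      hu1 (hm _)
  have hanti : ∀ u : A → B → ℝ, (∀ x, ∑ y, u x y = 1) →
      (∀ i t, fiberMass p (f i) u t = fiberMass p (f i) kbar t) →
      Antitone fun j => channelDiv p u (K j) := fun u hu1 hm =>
    antitone_nat_of_succ_le fun j => sub_nonneg.1 <|
      (Finset.sum_nonneg fun _ _ => sq_nonneg _).trans (hdesc u hu1 hm j)
  have hdiv : Tendsto (fun j => channelDiv p kbar (K j) - channelDiv p kbar (K (j + 1))) atTop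
      (𝓝 0) := by
    have h1 := tendsto_atTop_ciInf (hanti kbar hkbar1 fun _ _ => rfl)
      ⟨0, by
        rintro _ ⟨j, rfl⟩
        exact channelDiv_nonneg hp (fun x y => (hkbar x y).le) hkbar1 (hK j) (hK1 j)⟩
    simpa using h1.sub (h1.comp (tendsto_add_atTop_nat 1))
  have hmass : ∀ i t, Tendsto (fun j => fiberMass p (f i) (K j) t)
      (atTop ⊓ 𝓟 {j | s j = i}) (𝓝 (fiberMass p (f i) kbar t)) := fun i t => by
    refine tendsto_of_sq_sqrt_sub_sqrt (fiberMass_nonneg hp (fun x y => (hkbar x y).le) t)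
      (fun j => fiberMass_nonneg hp (fun x y => (hK j x y).le) t) ?_ (hdiv.mono_left inf_le_left)
    refine eventually_inf_principal.2 (Eventually.of_forall ?_)
    rintro j rfl
    exact (Finset.single_le_sum (f := fun t => (√(fiberMass p (f (s j)) kbar t)
      - √(fiberMass p (f (s j)) (K j) t)) ^ 2) (fun _ _ => sq_nonneg _)
      (Finset.mem_univ t)).trans (hdesc kbar hkbar1 (fun _ _ => rfl) j)
  have hsucc : Tendsto (fun j => K (j + 1) - K j) atTop (𝓝 0) := by
    simp_rw [hstep]
    exact tendsto_of_finite_cases s (fun i j => fiberScale p (f i) kbar (K j) - K j) fun i =>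
      tendsto_fiberScale_sub hp hkbar hK hK1 (hmass i)
  have hadd : ∀ r : ℕ, Tendsto (fun j => K (j + r) - K j) atTop (𝓝 0) := fun r => by
    induction r with
    | zero => simp
    | succ r ih =>
      have h1 := (hsucc.comp (tendsto_add_atTop_nat r)).add ih
      rw [add_zero] at h1
      exact h1.congr fun j => by simp [← add_assoc]
  have hmass_all : ∀ i t, Tendsto (fun j => fiberMass p (f i) (K j) t) atTop
      (𝓝 (fiberMass p (f i) kbar t)) := fun i t => by
    have hex : ∀ j, ∃ r : Fin n, s (j + r) = i := fun j => by
      have hlt := Nat.mod_lt (j + 1) hn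
      refine ⟨⟨(i + (n - (j + 1) % n)) % n, Nat.mod_lt _ hn⟩, Fin.ext ?_⟩
      have hi := i.2
      calc (j + (i + (n - (j + 1) % n)) % n + 1) % n
          = ((j + 1) + (i + (n - (j + 1) % n)) % n) % n := by congr 1; ring
        _ = ((j + 1) % n + (i + (n - (j + 1) % n))) % n := by
            rw [Nat.add_mod_mod, Nat.mod_add_mod]
        _ = (i + n) % n := by congr 1; omega
        _ = i := by rw [Nat.add_mod_right, Nat.mod_eq_of_lt hi]
    choose r hr using hex
    refine tendsto_of_finite_cases r (fun _ j => fiberMass p (f i) (K j) t) fun q => ?_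
    have h1 : Tendsto (fun j => j + (q : ℕ)) (atTop ⊓ 𝓟 {j | r j = q})
        (atTop ⊓ 𝓟 {j | s j = i}) := by
      refine tendsto_inf.2 ⟨(tendsto_add_atTop_nat _).mono_left inf_le_left, ?_⟩
      refine tendsto_principal.2 (eventually_inf_principal.2 (Eventually.of_forall ?_))
      rintro j rfl
      exact hr j
    have h2 : Tendsto (fun j => fiberMass p (f i) (K (j + q) - K j) t)
        (atTop ⊓ 𝓟 {j | r j = q}) (𝓝 0) := by
      have h3 := ((continuous_fiberMass p (f i) t).tendsto 0).comp
        ((hadd q).mono_left (inf_le_left (b := 𝓟 {j | r j = q})))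
      simpa [fiberMass, Function.comp_def] using h3
    have h4 := ((hmass i t).comp h1).sub h2
    rw [sub_zero] at h4
    exact h4.congr fun j => by simp [fiberMass_sub]
  obtain ⟨l, hl, φ, hφ, hlim⟩ := (isCompact_Icc (a := (0 : A → B → ℝ)) (b := 1)).tendsto_subseq
    (x := K) fun j => ⟨fun x y => (hK j x y).le, fun x => le_one_of_sum_eq_one (hK j x) (hK1 j x)⟩
  have hlim' : ∀ x y, Tendsto (fun j => K (φ j) x y) atTop (𝓝 (l x y)) := fun x y =>
    tendsto_pi_nhds.1 (tendsto_pi_nhds.1 hlim x) y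
  have hl0 : ∀ x y, 0 ≤ l x y := hl.1
  have hl1 : ∀ x, ∑ y, l x y = 1 := fun x =>
    tendsto_nhds_unique (tendsto_finsetSum _ fun y _ => hlim' x y) (by simp [hK1])
  have hlm : ∀ i t, fiberMass p (f i) l t = fiberMass p (f i) kbar t := fun i t =>
    tendsto_nhds_unique (((continuous_fiberMass p (f i) t).tendsto l).comp hlim)
      ((hmass_all i t).comp hφ.tendsto_atTop)
  refine ⟨l, ⟨hl0, hl1⟩, hlm, fun x y => ?_⟩
  have hsub : Tendsto (fun j => channelDiv p l (K (φ j))) atTop (𝓝 0) := by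
    have h1 : Tendsto (fun j => channelDiv p l (K (φ j))) atTop (𝓝 (∑ _x : A, ∑ _y : B, 0)) := by
      refine tendsto_finsetSum _ fun x _ => tendsto_finsetSum _ fun y _ => ?_
      rcases (hl0 x y).eq_or_lt with h | h
      · simp [← h]
      · have h2 := (((hlim' x y).log h.ne').const_sub (Real.log (l x y))).const_mul (l x y)
        simpa using h2.const_mul (p x)
    simpa using h1
  have hfull : Tendsto (fun j => channelDiv p l (K j)) atTop (𝓝 0) :=
    (tendsto_iff_tendsto_subseq_of_antitone (hanti l hl1 hlm) hφ.tendsto_atTop).2 hsub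
  refine tendsto_of_sq_sqrt_sub_sqrt (hl0 x y) (fun j => (hK j x y).le)
    (h := fun j => channelDiv p l (K j) / p x) (Eventually.of_forall fun j => ?_)
    (by simpa using hfull.div_const (p x))
  rw [le_div_iff₀ (hp x), mul_comm]
  exact mul_sq_sqrt_sub_sqrt_le_channelDiv hp hl0 hl1 (hK j) (hK1 j) x y

end FiberScaling

section Marginals

variable [∀ i, Fintype (X i)] [∀ i, DecidableEq (X i)]
  [∀ j, Fintype (Y j)] [∀ j, DecidableEq (Y j)]
  {p : (∀ i, X i) → ℝ}

lemma margP_restr_pos (hp : ∀ x, 0 < p x) (I : Finset (Fin N)) (x : ∀ i, X i) :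
    0 < margP p I (restr I x) := by
  refine Finset.sum_pos' (fun x' _ => ?_) ⟨x, Finset.mem_univ _, by simpa using hp x⟩
  split_ifs
  · exact (hp x').le
  · exact le_rfl

lemma margP_mul_margK (hp : ∀ x, 0 < p x) (k : (∀ i, X i) → (∀ j, Y j) → ℝ)
    (I : Finset (Fin N)) (J : Finset (Fin M)) (ξ : ∀ i : I, X i.1) (η : ∀ j : J, Y j.1) :
    margP p I ξ * margK p k I J ξ η
      = fiberMass p (fun x y => (restr I x, restr J y)) k (ξ, η) := by
  simp_rw [margK, fiberMass, Finset.mul_sum, Prod.mk.injEq]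
  refine Finset.sum_congr rfl fun x _ => Finset.sum_congr rfl fun y _ => ?_
  split_ifs with h
  · have := (margP_restr_pos hp I x).ne'
    rw [← h.1]
    field_simp
  · exact mul_zero _

lemma chScaleN_eq_fiberScale (hp : ∀ x, 0 < p x) (k kbar : (∀ i, X i) → (∀ j, Y j) → ℝ)
    (I : Finset (Fin N)) (J : Finset (Fin M)) :
    chScaleN p k I J (margK p kbar I J)
      = fiberScale p (fun x y => (restr I x, restr J y)) kbar k := by
  have h : ∀ x y, chScale p k I J (margK p kbar I J) x y
      = k x y * fiberRatio p (fun x y => (restr I x, restr J y)) kbar k x y := fun x y => by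
    rw [chScale, fiberRatio, ← margP_mul_margK hp, ← margP_mul_margK hp,
      mul_div_mul_left _ _ (margP_restr_pos hp I x).ne', mul_div_assoc]
  funext x y
  simp_rw [chScaleN, fiberScale, h]

end Marginals

/-- **Convergence of iterative scaling for channels:** the sequence of normalized
`IJ`-scalings converges (pointwise) to a channel lying in the intersection `M = ∩ᵢ Mᵢ`
of the prescribed-marginal mixture families. -/
theorem iterativeScaling_tendsto_mem
    {N M : ℕ} {X : Fin N → Type} {Y : Fin M → Type}
    [∀ i, Fintype (X i)] [∀ i, Nonempty (X i)] [∀ i, DecidableEq (X i)]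
    [∀ j, Fintype (Y j)] [∀ j, Nonempty (Y j)] [∀ j, DecidableEq (Y j)]
    (p : (∀ i, X i) → ℝ) (hp_pos : ∀ x, 0 < p x) (hp_sum : ∑ x, p x = 1)
    (kbar : (∀ i, X i) → (∀ j, Y j) → ℝ)
    (hkbar_pos : ∀ x y, 0 < kbar x y) (hkbar_sum : ∀ x, ∑ y, kbar x y = 1)
    {n : ℕ} (hn : 0 < n)
    (Is : Fin n → Finset (Fin N)) (Js : Fin n → Finset (Fin M))
    (hJs : ∀ i, (Js i).Nonempty)
    (k0 : (∀ i, X i) → (∀ j, Y j) → ℝ)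
    (hk0_pos : ∀ x y, 0 < k0 x y) (hk0_sum : ∀ x, ∑ y, k0 x y = 1) :
    ∃ l : (∀ i, X i) → (∀ j, Y j) → ℝ,
      ((∀ x y, 0 ≤ l x y) ∧ (∀ x, ∑ y, l x y = 1)) ∧
      (∀ i : Fin n, ∀ ξ η,
        margP p (Is i) ξ * margK p l (Is i) (Js i) ξ η
          = margP p (Is i) ξ * margK p kbar (Is i) (Js i) ξ η) ∧
      (∀ x y, Filter.Tendsto (fun j => scaleSeq p kbar Is Js hn k0 j x y)
        Filter.atTop (nhds (l x y))) := by
  obtain ⟨l, hl, hm, hlim⟩ := exists_tendsto_fiberScale_iterate hn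
    (fun i x y => (restr (Is i) x, restr (Js i) y)) (K := scaleSeq p kbar Is Js hn k0)
    hp_pos hp_sum hkbar_pos hkbar_sum hk0_pos hk0_sum
    fun j => by rw [scaleSeq, chScaleN_eq_fiberScale hp_pos]
  refine ⟨l, hl, fun i ξ η => ?_, hlim⟩
  rw [margP_mul_margK hp_pos, margP_mul_margK hp_pos]
  exact hm i (ξ, η)
end
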